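/- arXiv:2305.05117 — 2 statements merged into one kernel-verified Lean document; each statement's English description precedes it below -/
import Mathlib

section
/- Let m ≥ 1, h > 0, and let A be a symmetric real m×m matrix. Let Δt, C₁, β₀, β₁ ∈ ℝ, η₁ ∈ ℝ^m, and suppose P⁰, Q⁰, U⁰, P¹, Q¹, U¹ ∈ ℝ^m satisfy P¹ = P⁰ − Δt( A((Q¹+Q⁰)/2) + (1/4)·(U¹+U⁰) ⊙ (Q¹+Q⁰) ) + C₁ β₁ η₁ + (1/2)·Δt C₁ β₀ ( A η₁ + ((U¹+U⁰)/2) ⊙ η₁ ) and Q¹ = Q⁰ + Δt( A((P¹+P⁰)/2) + (1/4)·(U¹+U⁰) ⊙ (P¹+P⁰) ) − C₁ β₀ η₁ + (1/2)·Δt C₁ β₁ ( A η₁ + ((U¹+U⁰)/2) ⊙ η₁ ). Then ‖P¹‖_h² + ‖Q¹‖_h² = ‖P⁰ + C₁ β₁ η₁‖_h² + ‖Q⁰ − C₁ β₀ η₁‖_h²; that is, one step of the modified midpoint scheme exactly transports the discrete charge of the noise-kicked data. -/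
open MeasureTheory ProbabilityTheory

/-- Weighted discrete inner product `⟨f, g⟩_h = h ∑ i f i * g i`. -/
noncomputable def iph {m : ℕ} (h : ℝ) (f g : Fin m → ℝ) : ℝ := h * ∑ i, f i * g i

/-- Squared discrete norm `‖f‖_h² = h ∑ i (f i)²`. -/
noncomputable def nsq {m : ℕ} (h : ℝ) (f : Fin m → ℝ) : ℝ := h * ∑ i, f i * f i

/-- If `P1 - p = -c B (Q1 + q)` and `Q1 - q = c B (P1 + p)` with `B` symmetric, then the charge
is transported exactly. -/
theorem nsq_add_nsq_eq_of_midpoint {m : ℕ} (h c : ℝ) {B : Matrix (Fin m) (Fin m) ℝ}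
    (hB : B.IsSymm) {P1 Q1 p q : Fin m → ℝ} (hP : P1 - p = -(c • B.mulVec (Q1 + q)))
    (hQ : Q1 - q = c • B.mulVec (P1 + p)) :
    nsq h P1 + nsq h Q1 = nsq h p + nsq h q := by
  have hdot : ∀ f : Fin m → ℝ, nsq h f = h * f ⬝ᵥ f := fun _ => rfl
  have hcross : (P1 + p) ⬝ᵥ (P1 - p) + (Q1 + q) ⬝ᵥ (Q1 - q) = 0 := by
    rw [hP, hQ, dotProduct_neg, dotProduct_smul, dotProduct_smul, Matrix.dotProduct_mulVec,
      ← Matrix.mulVec_transpose, hB.eq, dotProduct_comm (B.mulVec (P1 + p)), neg_add_cancel]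
  simp only [add_dotProduct, dotProduct_sub, dotProduct_comm p P1, dotProduct_comm q Q1] at hcross
  simp only [hdot]
  linear_combination h * hcross

/-- One step of the modified midpoint scheme exactly transports the discrete
charge of the noise-kicked data. -/
theorem stmt_6 {m : ℕ} (hm : 1 ≤ m) (h : ℝ) (hh : 0 < h)
    (A : Matrix (Fin m) (Fin m) ℝ) (hA : A.IsSymm)
    (Δt C1 β0 β1 : ℝ) (η1 P0 Q0 U0 P1 Q1 U1 : Fin m → ℝ)
    (hP : P1 = P0
        - Δt • (A.mulVec ((2 : ℝ)⁻¹ • (Q1 + Q0)) + (4 : ℝ)⁻¹ • ((U1 + U0) * (Q1 + Q0)))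
        + (C1 * β1) • η1
        + ((2 : ℝ)⁻¹ * Δt * C1 * β0) • (A.mulVec η1 + ((2 : ℝ)⁻¹ • (U1 + U0)) * η1))
    (hQ : Q1 = Q0
        + Δt • (A.mulVec ((2 : ℝ)⁻¹ • (P1 + P0)) + (4 : ℝ)⁻¹ • ((U1 + U0) * (P1 + P0)))
        - (C1 * β0) • η1
        + ((2 : ℝ)⁻¹ * Δt * C1 * β1) • (A.mulVec η1 + ((2 : ℝ)⁻¹ • (U1 + U0)) * η1)) :
    nsq h P1 + nsq h Q1
      = nsq h (P0 + (C1 * β1) • η1) + nsq h (Q0 - (C1 * β0) • η1) := by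
  have hB : (A + Matrix.diagonal ((2 : ℝ)⁻¹ • (U1 + U0))).IsSymm :=
    hA.add (Matrix.isSymm_diagonal _)
  refine nsq_add_nsq_eq_of_midpoint h ((2 : ℝ)⁻¹ * Δt) hB ?_ ?_
  · ext i
    have hi := congrFun hP i
    simp only [Matrix.add_mulVec, Matrix.mulVec_add, Matrix.mulVec_sub, Matrix.mulVec_smul,
      Matrix.mulVec_diagonal, Pi.add_apply, Pi.sub_apply, Pi.neg_apply, Pi.smul_apply,
      Pi.mul_apply, smul_eq_mul] at hi ⊢
    linear_combination hi
  · ext i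
    have hi := congrFun hQ i
    simp only [Matrix.add_mulVec, Matrix.mulVec_add, Matrix.mulVec_smul,
      Matrix.mulVec_diagonal, Pi.add_apply, Pi.sub_apply, Pi.smul_apply,
      Pi.mul_apply, smul_eq_mul] at hi ⊢
    linear_combination hi
end

section
/- Let (Ω, ℱ, ℙ) be a probability space, M ≥ 2, h > 0, Δt > 0, C₁ ∈ ℝ, η₁ ∈ ℝ^{M−1}, and let A be the central-difference matrix. Let Pⁿ, Qⁿ, Uⁿ : Ω → ℝ^{M−1} (0 ≤ n ≤ N) be random vectors with E‖Pⁿ‖_h² < ∞ and E‖Qⁿ‖_h² < ∞ for all n, and for each 1 ≤ n ≤ N let β₀ⁿ, β₁ⁿ be N(0, Δt)-distributed real random variables such that the pair (β₀ⁿ, β₁ⁿ) is independent of the pair (Pⁿ⁻¹, Qⁿ⁻¹). Suppose that almost surely, for each 1 ≤ n ≤ N, Pⁿ = Pⁿ⁻¹ − Δt( A((Qⁿ+Qⁿ⁻¹)/2) + (1/4)·(Uⁿ+Uⁿ⁻¹) ⊙ (Qⁿ+Qⁿ⁻¹) ) + C₁ β₁ⁿ η₁ + (1/2)·Δt C₁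 β₀ⁿ ( A η₁ + ((Uⁿ+Uⁿ⁻¹)/2) ⊙ η₁ ) and Qⁿ = Qⁿ⁻¹ + Δt( A((Pⁿ+Pⁿ⁻¹)/2) + (1/4)·(Uⁿ+Uⁿ⁻¹) ⊙ (Pⁿ+Pⁿ⁻¹) ) − C₁ β₀ⁿ η₁ + (1/2)·Δt C₁ β₁ⁿ ( A η₁ + ((Uⁿ+Uⁿ⁻¹)/2) ⊙ η₁ ). Then for every 0 ≤ n ≤ N, E[𝒩(Pⁿ, Qⁿ)] = E[𝒩(P⁰, Q⁰)] + 2 C₁² ‖η₁‖_h² · n Δt. -/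
open MeasureTheory ProbabilityTheory

/-- The `(M-1) × (M-1)` central-difference matrix: `-2/h²` on the diagonal and
`1/h²` on the first super- and sub-diagonals. -/
noncomputable def cdMatrix (M : ℕ) (h : ℝ) : Matrix (Fin (M - 1)) (Fin (M - 1)) ℝ :=
  Matrix.of fun i j =>
    if (i : ℕ) = (j : ℕ) then -2 / h ^ 2
    else if (i : ℕ) + 1 = (j : ℕ) ∨ (j : ℕ) + 1 = (i : ℕ) then 1 / h ^ 2
    else 0

/-- The implicit midpoint rule for a skew-coupled linear system with symmetric coefficient matrix
preserves the quadratic charge. -/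
theorem dotProduct_self_add_of_midpoint {m : ℕ} {L : Matrix (Fin m) (Fin m) ℝ} (hL : L.IsSymm)
    (c : ℝ) {a b p q : Fin m → ℝ} (hp : p - a = -(c • L.mulVec (q + b)))
    (hq : q - b = c • L.mulVec (p + a)) :
    p ⬝ᵥ p + q ⬝ᵥ q = a ⬝ᵥ a + b ⬝ᵥ b := by
  have hsymm : (p + a) ⬝ᵥ L.mulVec (q + b) = (q + b) ⬝ᵥ L.mulVec (p + a) := by
    rw [Matrix.dotProduct_mulVec, ← Matrix.mulVec_transpose, hL.eq, dotProduct_comm]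
  have h1 : (p + a) ⬝ᵥ (p - a) = -(c * ((p + a) ⬝ᵥ L.mulVec (q + b))) := by
    rw [hp, dotProduct_neg, dotProduct_smul, smul_eq_mul]
  have h2 : (q + b) ⬝ᵥ (q - b) = c * ((q + b) ⬝ᵥ L.mulVec (p + a)) := by
    rw [hq, dotProduct_smul, smul_eq_mul]
  rw [hsymm] at h1
  simp only [add_dotProduct, dotProduct_sub] at h1 h2
  rw [dotProduct_comm a p] at h1
  rw [dotProduct_comm b q] at h2
  linarith

theorem cdMatrix_isSymm (M : ℕ) (h : ℝ) : (cdMatrix M h).IsSymm := by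
  ext i j
  simp only [Matrix.transpose_apply, cdMatrix, Matrix.of_apply, eq_comm (a := (j : ℕ)),
    or_comm (a := (j : ℕ) + 1 = (i : ℕ))]

theorem nsq_eq_dotProduct {m : ℕ} (h : ℝ) (f : Fin m → ℝ) : nsq h f = h * (f ⬝ᵥ f) := rfl

theorem iph_eq_dotProduct {m : ℕ} (h : ℝ) (f g : Fin m → ℝ) : iph h f g = h * (f ⬝ᵥ g) := rfl

theorem nsq_add_smul {m : ℕ} (h c : ℝ) (f g : Fin m → ℝ) :
    nsq h (f + c • g) = nsq h f + 2 * c * iph h f g + c ^ 2 * nsq h g := by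
  simp only [nsq_eq_dotProduct, iph_eq_dotProduct, add_dotProduct, dotProduct_add,
    smul_dotProduct, dotProduct_smul, smul_eq_mul, dotProduct_comm g f]
  ring

/-- Pathwise charge balance for one step of the modified midpoint scheme. -/
theorem nsq_add_nsq_of_step {m : ℕ} {A : Matrix (Fin m) (Fin m) ℝ} (hA : A.IsSymm)
    (h Δt C b0 b1 : ℝ) {η p q p' q' u : Fin m → ℝ}
    (hp : p' = p - Δt • (A.mulVec ((2 : ℝ)⁻¹ • (q' + q)) + (4 : ℝ)⁻¹ • (u * (q' + q)))
      + (C * b1) • η + ((2 : ℝ)⁻¹ * Δt * C * b0) • (A.mulVec η + ((2 : ℝ)⁻¹ • u) * η))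
    (hq : q' = q + Δt • (A.mulVec ((2 : ℝ)⁻¹ • (p' + p)) + (4 : ℝ)⁻¹ • (u * (p' + p)))
      - (C * b0) • η + ((2 : ℝ)⁻¹ * Δt * C * b1) • (A.mulVec η + ((2 : ℝ)⁻¹ • u) * η)) :
    nsq h p' + nsq h q' = nsq h p + nsq h q
      + 2 * C * (b1 * iph h p η - b0 * iph h q η) + C ^ 2 * (b0 ^ 2 + b1 ^ 2) * nsq h η := by
  have hL : (A + Matrix.diagonal ((2 : ℝ)⁻¹ • u)).IsSymm :=
    hA.add (Matrix.isSymm_diagonal _)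
  have key := dotProduct_self_add_of_midpoint hL (2⁻¹ * Δt)
    (a := p + (C * b1) • η) (b := q + (-(C * b0)) • η) (p := p') (q := q') ?_ ?_
  · have hfree : nsq h p' + nsq h q'
        = nsq h (p + (C * b1) • η) + nsq h (q + (-(C * b0)) • η) := by
      simp only [nsq_eq_dotProduct, ← mul_add, key]
    rw [hfree, nsq_add_smul, nsq_add_smul]
    ring
  · ext i
    have := congrFun hp i
    simp only [Matrix.add_mulVec, Matrix.mulVec_add, Matrix.mulVec_smul, Matrix.mulVec_diagonal,
      Pi.add_apply, Pi.sub_apply, Pi.smul_apply, Pi.mul_apply, Pi.neg_apply, smul_eq_mul]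
      at this ⊢
    linear_combination this
  · ext i
    have := congrFun hq i
    simp only [Matrix.add_mulVec, Matrix.mulVec_add, Matrix.mulVec_smul, Matrix.mulVec_diagonal,
      Pi.add_apply, Pi.sub_apply, Pi.smul_apply, Pi.mul_apply, smul_eq_mul]
      at this ⊢
    linear_combination this

theorem measurable_iph_left {m : ℕ} (h : ℝ) (g : Fin m → ℝ) :
    Measurable fun f : Fin m → ℝ => iph h f g := by
  unfold iph
  fun_prop

/-- A random vector with integrable squared discrete norm has integrable discrete inner product
with any fixed vector. -/
theorem integrable_iph {Ω : Type*} [MeasurableSpace Ω] {μ : Measure Ω} [IsFiniteMeasure μ]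
    {m : ℕ} {h : ℝ} (hh : 0 < h) {X : Ω → Fin m → ℝ} (hX : Measurable X)
    (hXi : Integrable (fun ω => nsq h (X ω)) μ) (g : Fin m → ℝ) :
    Integrable (fun ω => iph h (X ω) g) μ := by
  refine ((hXi.add (integrable_const (nsq h g))).mono'
    ((measurable_iph_left h g).comp hX).aestronglyMeasurable (ae_of_all _ fun ω => ?_))
  have hnonneg : ∀ f : Fin m → ℝ, 0 ≤ nsq h f := fun f =>
    mul_nonneg hh.le (Finset.sum_nonneg fun i _ => mul_self_nonneg _)
  have h1 := hnonneg (X ω + (1 : ℝ) • g)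
  have h2 := hnonneg (X ω + (-1 : ℝ) • g)
  rw [nsq_add_smul] at h1 h2
  have h3 := hnonneg (X ω)
  have h4 := hnonneg g
  rw [Real.norm_eq_abs, Pi.add_apply, abs_le]
  constructor <;> linarith

section Gaussian

variable {Ω : Type*} [MeasurableSpace Ω] {μ : Measure Ω} {X : Ω → ℝ} {v : NNReal}

theorem memLp_two_of_map_eq_gaussianReal (hX : Measurable X)
    (hmap : μ.map X = gaussianReal 0 v) : MemLp X 2 μ := by
  have := memLp_id_gaussianReal' (μ := 0) (v := v) 2 (by simp)
  rw [← hmap] at this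
  exact this.comp_of_map hX.aemeasurable

theorem integral_eq_zero_of_map_eq_gaussianReal (hX : Measurable X)
    (hmap : μ.map X = gaussianReal 0 v) : ∫ ω, X ω ∂μ = 0 := by
  have := integral_id_gaussianReal (μ := 0) (v := v)
  rwa [← hmap, integral_map hX.aemeasurable (by fun_prop)] at this

theorem integral_sq_of_map_eq_gaussianReal (hX : Measurable X)
    (hmap : μ.map X = gaussianReal 0 v) : ∫ ω, X ω ^ 2 ∂μ = v := by
  have := variance_of_integral_eq_zero (μ := gaussianReal 0 v) (X := fun x => x)
    (by fun_prop) integral_id_gaussianReal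
  rw [variance_fun_id_gaussianReal, ← hmap, integral_map hX.aemeasurable (by fun_prop)] at this
  exact this.symm

end Gaussian

/-- The modified midpoint fully-discrete scheme (central difference in space)
preserves the averaged charge evolution law. -/
theorem stmt_7 {Ω : Type*} [MeasureSpace Ω] [IsProbabilityMeasure (ℙ : Measure Ω)]
    {M : ℕ} (hM : 2 ≤ M) (h : ℝ) (hh : 0 < h) (Δt : ℝ) (hΔt : 0 < Δt)
    (C1 : ℝ) (η1 : Fin (M - 1) → ℝ) (N : ℕ)
    (P Q U : ℕ → Ω → Fin (M - 1) → ℝ)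
    (hPm : ∀ n ≤ N, Measurable (P n)) (hQm : ∀ n ≤ N, Measurable (Q n))
    (hPi : ∀ n ≤ N, Integrable (fun ω => nsq h (P n ω)) ℙ)
    (hQi : ∀ n ≤ N, Integrable (fun ω => nsq h (Q n ω)) ℙ)
    (β0 β1 : ℕ → Ω → ℝ)
    (hβ0m : ∀ n, 1 ≤ n → n ≤ N → Measurable (β0 n))
    (hβ1m : ∀ n, 1 ≤ n → n ≤ N → Measurable (β1 n))
    (hβ0 : ∀ n, 1 ≤ n → n ≤ N → Measure.map (β0 n) ℙ = gaussianReal 0 Δt.toNNReal)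
    (hβ1 : ∀ n, 1 ≤ n → n ≤ N → Measure.map (β1 n) ℙ = gaussianReal 0 Δt.toNNReal)
    (hind : ∀ n, 1 ≤ n → n ≤ N →
      IndepFun (fun ω => (β0 n ω, β1 n ω)) (fun ω => (P (n - 1) ω, Q (n - 1) ω)) ℙ)
    (hscheme : ∀ᵐ ω ∂ℙ, ∀ n, 1 ≤ n → n ≤ N →
      P n ω = P (n - 1) ω
          - Δt • ((cdMatrix M h).mulVec ((2 : ℝ)⁻¹ • (Q n ω + Q (n - 1) ω))
              + (4 : ℝ)⁻¹ • ((U n ω + U (n - 1) ω) * (Q n ω + Q (n - 1) ω)))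
          + (C1 * β1 n ω) • η1
          + ((2 : ℝ)⁻¹ * Δt * C1 * β0 n ω) • ((cdMatrix M h).mulVec η1
              + ((2 : ℝ)⁻¹ • (U n ω + U (n - 1) ω)) * η1)
      ∧ Q n ω = Q (n - 1) ω
          + Δt • ((cdMatrix M h).mulVec ((2 : ℝ)⁻¹ • (P n ω + P (n - 1) ω))
              + (4 : ℝ)⁻¹ • ((U n ω + U (n - 1) ω) * (P n ω + P (n - 1) ω)))
          - (C1 * β0 n ω) • η1
          + ((2 : ℝ)⁻¹ * Δt * C1 * β1 n ω) • ((cdMatrix M h).mulVec η1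
              + ((2 : ℝ)⁻¹ • (U n ω + U (n - 1) ω)) * η1)) :
    ∀ n ≤ N, ∫ ω, (nsq h (P n ω) + nsq h (Q n ω)) ∂ℙ
      = (∫ ω, (nsq h (P 0 ω) + nsq h (Q 0 ω)) ∂ℙ) + 2 * C1 ^ 2 * nsq h η1 * (n * Δt) := by
  intro n
  induction n with
  | zero => intro _; simp
  | succ n ih =>
    intro hn
    have hn' : n ≤ N := by omega
    have h1 : 1 ≤ n + 1 := by omega
    have m0 := hβ0m _ h1 hn
    have m1 := hβ1m _ h1 hn
    have l0 := memLp_two_of_map_eq_gaussianReal m0 (hβ0 _ h1 hn)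
    have l1 := memLp_two_of_map_eq_gaussianReal m1 (hβ1 _ h1 hn)
    have e0 := integral_eq_zero_of_map_eq_gaussianReal m0 (hβ0 _ h1 hn)
    have e1 := integral_eq_zero_of_map_eq_gaussianReal m1 (hβ1 _ h1 hn)
    have v0 := integral_sq_of_map_eq_gaussianReal m0 (hβ0 _ h1 hn)
    have v1 := integral_sq_of_map_eq_gaussianReal m1 (hβ1 _ h1 hn)
    rw [Real.coe_toNNReal _ hΔt.le] at v0 v1
    have hpair := hind _ h1 hn
    rw [Nat.add_sub_cancel] at hpair
    have miph := measurable_iph_left h η1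
    have indP : IndepFun (β1 (n + 1)) (fun ω => iph h (P n ω) η1) ℙ :=
      hpair.comp measurable_snd (miph.comp measurable_fst)
    have indQ : IndepFun (β0 (n + 1)) (fun ω => iph h (Q n ω) η1) ℙ :=
      hpair.comp measurable_fst (miph.comp measurable_snd)
    have iP := integrable_iph hh (hPm n hn') (hPi n hn') η1
    have iQ := integrable_iph hh (hQm n hn') (hQi n hn') η1
    have iβP : Integrable (fun ω => β1 (n + 1) ω * iph h (P n ω) η1) ℙ :=
      indP.integrable_mul (l1.integrable one_le_two) iP
    have iβQ : Integrable (fun ω => β0 (n + 1) ω * iph h (Q n ω) η1) ℙ :=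
      indQ.integrable_mul (l0.integrable one_le_two) iQ
    have zP : ∫ ω, β1 (n + 1) ω * iph h (P n ω) η1 ∂ℙ = 0 := by
      rw [indP.integral_fun_mul_eq_mul_integral m1.aestronglyMeasurable iP.1, e1, zero_mul]
    have zQ : ∫ ω, β0 (n + 1) ω * iph h (Q n ω) η1 ∂ℙ = 0 := by
      rw [indQ.integral_fun_mul_eq_mul_integral m0.aestronglyMeasurable iQ.1, e0, zero_mul]
    have iN : Integrable (fun ω => nsq h (P n ω) + nsq h (Q n ω)) ℙ :=
      (hPi n hn').add (hQi n hn')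
    have iC : Integrable (fun ω => 2 * C1 * (β1 (n + 1) ω * iph h (P n ω) η1
        - β0 (n + 1) ω * iph h (Q n ω) η1)) ℙ := (iβP.sub iβQ).const_mul _
    have iS : Integrable (fun ω => C1 ^ 2 * (β0 (n + 1) ω ^ 2 + β1 (n + 1) ω ^ 2)
        * nsq h η1) ℙ := ((l0.integrable_sq.add l1.integrable_sq).const_mul _).mul_const _
    have hstep : ∀ᵐ ω ∂ℙ, nsq h (P (n + 1) ω) + nsq h (Q (n + 1) ω)
        = nsq h (P n ω) + nsq h (Q n ω)
          + 2 * C1 * (β1 (n + 1) ω * iph h (P n ω) η1 - β0 (n + 1) ω * iph h (Q n ω) η1)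
          + C1 ^ 2 * (β0 (n + 1) ω ^ 2 + β1 (n + 1) ω ^ 2) * nsq h η1 := by
      filter_upwards [hscheme] with ω hω
      obtain ⟨hp, hq⟩ := hω _ h1 hn
      exact nsq_add_nsq_of_step (cdMatrix_isSymm M h) h Δt C1 _ _ hp hq
    rw [integral_congr_ae hstep, integral_add (by exact iN.add iC) iS, integral_add iN iC, ih hn',
      integral_const_mul, integral_sub iβP iβQ, zP, zQ, integral_mul_const, integral_const_mul,
      integral_add l0.integrable_sq l1.integrable_sq, v0, v1]
    push_cast
    ring
end
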